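/- Let n ≥ 2 and let Φ₀, Φ₁ ∈ H satisfy ⟨Φ₀, Φ₁⟩ = 0 and ⟨Φ₀, γ(v)Φ₁⟩ = 0 for every v ∈ ℝⁿ. Set φ = ψ⁻_{Φ₀} + ψ⁺_{Φ₁}. Then for every x ∈ ℝⁿ: ‖φ(x)‖² = 2ⁿ (1+‖x‖²)^{1−n} (‖Φ₀‖² + ‖Φ₁‖²) and ‖Dφ(x)‖² = n² · 2ⁿ · (1+‖x‖²)^{−n−1} (‖Φ₀‖² + ‖Φ₁‖²). -/

import Mathlib

open scoped RealInnerProductSpace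
open MeasureTheory

noncomputable section

/-- The Dirac operator on spinor fields `ψ : ℝⁿ → H`, relative to Clifford
multiplication `γ` and the standard orthonormal basis of `ℝⁿ`. -/
def Dirac {n : ℕ} {H : Type*} [NormedAddCommGroup H] [InnerProductSpace ℝ H]
    (γ : EuclideanSpace ℝ (Fin n) →ₗ[ℝ] H →ₗ[ℝ] H)
    (ψ : EuclideanSpace ℝ (Fin n) → H) (x : EuclideanSpace ℝ (Fin n)) : H :=
  ∑ i : Fin n, γ (EuclideanSpace.single i (1 : ℝ))
    (fderiv ℝ ψ x (EuclideanSpace.single i (1 : ℝ)))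

/-- The spinor bubble `ψ⁻_Φ(x) = (2/(1+‖x‖²))^{n/2} (Φ − γ(x)Φ)`. -/
def psiNeg {n : ℕ} {H : Type*} [NormedAddCommGroup H] [InnerProductSpace ℝ H]
    (γ : EuclideanSpace ℝ (Fin n) →ₗ[ℝ] H →ₗ[ℝ] H)
    (Φ : H) (x : EuclideanSpace ℝ (Fin n)) : H :=
  (((2 / (1 + ‖x‖ ^ 2) : ℝ)) ^ ((n : ℝ) / 2)) • (Φ - γ x Φ)

/-- The spinor bubble `ψ⁺_Φ(x) = (2/(1+‖x‖²))^{n/2} (Φ + γ(x)Φ)`. -/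
def psiPos {n : ℕ} {H : Type*} [NormedAddCommGroup H] [InnerProductSpace ℝ H]
    (γ : EuclideanSpace ℝ (Fin n) →ₗ[ℝ] H →ₗ[ℝ] H)
    (Φ : H) (x : EuclideanSpace ℝ (Fin n)) : H :=
  (((2 / (1 + ‖x‖ ^ 2) : ℝ)) ^ ((n : ℝ) / 2)) • (Φ + γ x Φ)

/-- The square of Clifford multiplication by `v` is `-‖v‖²`. -/
theorem clifford_mul_self {E H : Type*} [NormedAddCommGroup E] [InnerProductSpace ℝ E]
    [NormedAddCommGroup H] [InnerProductSpace ℝ H] (γ : E →ₗ[ℝ] H →ₗ[ℝ] H)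
    (hcl : ∀ (v w : E) (ψ : H), γ v (γ w ψ) + γ w (γ v ψ) = (-2 * ⟪v, w⟫) • ψ)
    (v : E) (ψ : H) : γ v (γ v ψ) = (-‖v‖ ^ 2) • ψ := by
  have h := hcl v v ψ
  rw [real_inner_self_eq_norm_sq, ← two_smul ℝ (γ v (γ v ψ)),
    show -2 * ‖v‖ ^ 2 = 2 * -‖v‖ ^ 2 by ring, mul_smul] at h
  exact smul_right_injective H (two_ne_zero (α := ℝ)) h

theorem norm_sq_clifford_mul {E H : Type*} [NormedAddCommGroup E] [InnerProductSpace ℝ E]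
    [NormedAddCommGroup H] [InnerProductSpace ℝ H] (γ : E →ₗ[ℝ] H →ₗ[ℝ] H)
    (hcl : ∀ (v w : E) (ψ : H), γ v (γ w ψ) + γ w (γ v ψ) = (-2 * ⟪v, w⟫) • ψ)
    (hsk : ∀ (v : E) (φ ψ : H), ⟪γ v φ, ψ⟫ = - ⟪φ, γ v ψ⟫)
    (v : E) (ψ : H) : ‖γ v ψ‖ ^ 2 = ‖v‖ ^ 2 * ‖ψ‖ ^ 2 := by
  rw [← real_inner_self_eq_norm_sq, hsk, clifford_mul_self γ hcl, real_inner_smul_right,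
    real_inner_self_eq_norm_sq]
  ring

theorem norm_sq_add_clifford_mul {E H : Type*} [NormedAddCommGroup E] [InnerProductSpace ℝ E]
    [NormedAddCommGroup H] [InnerProductSpace ℝ H] (γ : E →ₗ[ℝ] H →ₗ[ℝ] H)
    (hcl : ∀ (v w : E) (ψ : H), γ v (γ w ψ) + γ w (γ v ψ) = (-2 * ⟪v, w⟫) • ψ)
    (hsk : ∀ (v : E) (φ ψ : H), ⟪γ v φ, ψ⟫ = - ⟪φ, γ v ψ⟫)
    {A B : H} (hAB : ∀ v : E, ⟪A, γ v B⟫ = 0) (v : E) :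
    ‖A + γ v B‖ ^ 2 = ‖A‖ ^ 2 + ‖v‖ ^ 2 * ‖B‖ ^ 2 := by
  rw [norm_add_sq_real, hAB, norm_sq_clifford_mul γ hcl hsk]
  ring

/-- The gradient of the conformal factor `(2 / (1 + ‖x‖²)) ^ p`. -/
theorem hasFDerivAt_two_div_one_add_norm_sq_rpow {E : Type*} [NormedAddCommGroup E]
    [InnerProductSpace ℝ E] (p : ℝ) (x : E) :
    HasFDerivAt (fun y : E => (2 / (1 + ‖y‖ ^ 2)) ^ p)
      ((-(2 * p) * (2 / (1 + ‖x‖ ^ 2)) ^ p / (1 + ‖x‖ ^ 2)) • innerSL ℝ x) x := by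
  have hpos : 0 < 1 + ‖x‖ ^ 2 := by positivity
  have h := ((((hasDerivAt_id (‖x‖ ^ 2)).const_add 1).inv hpos.ne').const_mul 2).rpow_const
    (p := p) (Or.inl (by simp only [id, Pi.inv_apply]; positivity))
  have h' := h.comp_hasFDerivAt x (hasStrictFDerivAt_norm_sq x).hasFDerivAt
  refine (h'.congr_fderiv ?_).congr_of_eventuallyEq (.of_forall fun y => ?_)
  · rw [two_smul, ← two_smul ℝ (innerSL ℝ x), smul_smul]
    congr 1
    simp only [id, Pi.inv_apply]
    rw [Real.rpow_sub_one (by positivity), ← div_eq_mul_inv]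
    field_simp
  · simp [div_eq_mul_inv]

theorem sum_inner_smul_clifford {n : ℕ} {H : Type*} [NormedAddCommGroup H]
    [InnerProductSpace ℝ H] (γ : EuclideanSpace ℝ (Fin n) →ₗ[ℝ] H →ₗ[ℝ] H)
    (x : EuclideanSpace ℝ (Fin n)) (ψ : H) :
    ∑ i : Fin n, ⟪x, EuclideanSpace.single i (1 : ℝ)⟫ • γ (EuclideanSpace.single i 1) ψ =
      γ x ψ := by
  have h := (EuclideanSpace.basisFun (Fin n) ℝ).sum_repr' x
  conv_rhs => rw [← h]
  simp [real_inner_comm]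

/-- The Dirac operator applied to `f(x) (A + γ(x) B)` where `f` has gradient `c x` at `x`. -/
theorem Dirac_smul_add_clifford {n : ℕ} {H : Type*} [NormedAddCommGroup H]
    [InnerProductSpace ℝ H] (γ : EuclideanSpace ℝ (Fin n) →ₗ[ℝ] H →ₗ[ℝ] H)
    (hcl : ∀ (v w : EuclideanSpace ℝ (Fin n)) (ψ : H),
      γ v (γ w ψ) + γ w (γ v ψ) = (-2 * ⟪v, w⟫) • ψ)
    (A B : H) {f : EuclideanSpace ℝ (Fin n) → ℝ} {c : ℝ} {x : EuclideanSpace ℝ (Fin n)}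
    (hf : HasFDerivAt f (c • innerSL ℝ x) x) :
    Dirac γ (fun y => f y • (A + γ y B)) x =
      c • γ x A - (c * ‖x‖ ^ 2 + n * f x) • B := by
  have hγ : HasFDerivAt (fun y => A + γ y B) (LinearMap.toContinuousLinearMap (γ.flip B)) x :=
    (LinearMap.toContinuousLinearMap (γ.flip B)).hasFDerivAt.const_add A
  have hD (i : Fin n) : γ (EuclideanSpace.single i (1 : ℝ))
      (fderiv ℝ (fun y => f y • (A + γ y B)) x (EuclideanSpace.single i (1 : ℝ))) =
      c • ⟪x, EuclideanSpace.single i (1 : ℝ)⟫ • γ (EuclideanSpace.single i 1) (A + γ x B) -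
        f x • B := by
    rw [HasFDerivAt.fderiv (f := fun y => f y • (A + γ y B)) (hf.smul hγ)]
    simp [clifford_mul_self γ hcl, mul_smul, sub_eq_add_neg, add_comm]
  simp only [Dirac, hD]
  rw [Finset.sum_sub_distrib, ← Finset.smul_sum, sum_inner_smul_clifford, map_add,
    clifford_mul_self γ hcl, Finset.sum_const, Finset.card_univ, Fintype.card_fin,
    ← Nat.cast_smul_eq_nsmul ℝ]
  module

theorem two_div_rpow_half_sq (n : ℕ) {t : ℝ} (ht : 0 < t) :
    ((2 / t) ^ ((n : ℝ) / 2)) ^ 2 = 2 ^ n * t ^ (-(n : ℝ)) := by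
  rw [← Real.rpow_mul_natCast (by positivity), Nat.cast_ofNat, div_mul_cancel₀ _ two_ne_zero,
    Real.rpow_natCast, Real.rpow_neg ht.le, Real.rpow_natCast, div_pow, div_eq_mul_inv]

/-- For `n ≥ 2` and `Φ₀, Φ₁ ∈ H` with `⟨Φ₀, Φ₁⟩ = 0` and
`⟨Φ₀, γ(v)Φ₁⟩ = 0` for all `v`, the spinor field `φ = ψ⁻_{Φ₀} + ψ⁺_{Φ₁}` satisfies
`‖φ(x)‖² = 2ⁿ (1+‖x‖²)^{1−n} (‖Φ₀‖² + ‖Φ₁‖²)` and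
`‖Dφ(x)‖² = n² 2ⁿ (1+‖x‖²)^{−n−1} (‖Φ₀‖² + ‖Φ₁‖²)` for every `x ∈ ℝⁿ`. -/
theorem norm_sq_of_bubble_combination {n : ℕ} {H : Type*} [NormedAddCommGroup H]
    [InnerProductSpace ℝ H] [FiniteDimensional ℝ H]
    (hn : 2 ≤ n)
    (γ : EuclideanSpace ℝ (Fin n) →ₗ[ℝ] H →ₗ[ℝ] H)
    (hcl : ∀ (v w : EuclideanSpace ℝ (Fin n)) (ψ : H),
      γ v (γ w ψ) + γ w (γ v ψ) = (-2 * ⟪v, w⟫) • ψ)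
    (hsk : ∀ (v : EuclideanSpace ℝ (Fin n)) (φ ψ : H),
      ⟪γ v φ, ψ⟫ = - ⟪φ, γ v ψ⟫)
    (Φ₀ Φ₁ : H) (h01 : ⟪Φ₀, Φ₁⟫ = 0)
    (h01' : ∀ v : EuclideanSpace ℝ (Fin n), ⟪Φ₀, γ v Φ₁⟫ = 0)
    (φ : EuclideanSpace ℝ (Fin n) → H)
    (hφ : φ = fun x => psiNeg γ Φ₀ x + psiPos γ Φ₁ x)
    (x : EuclideanSpace ℝ (Fin n)) :
    ‖φ x‖ ^ 2 =
      (2 : ℝ) ^ n * (1 + ‖x‖ ^ 2) ^ ((1 : ℝ) - (n : ℝ)) * (‖Φ₀‖ ^ 2 + ‖Φ₁‖ ^ 2) ∧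
    ‖Dirac γ φ x‖ ^ 2 =
      (n : ℝ) ^ 2 * (2 : ℝ) ^ n * (1 + ‖x‖ ^ 2) ^ (-(n : ℝ) - 1) *
        (‖Φ₀‖ ^ 2 + ‖Φ₁‖ ^ 2) := by
  have hself (v : EuclideanSpace ℝ (Fin n)) (ψ : H) : ⟪ψ, γ v ψ⟫ = 0 := by
    have h := hsk v ψ ψ
    rw [real_inner_comm] at h
    linarith
  have h10 (v : EuclideanSpace ℝ (Fin n)) : ⟪Φ₁, γ v Φ₀⟫ = 0 := by
    have h := hsk v Φ₁ Φ₀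
    rw [real_inner_comm, h01'] at h
    linarith
  have hAB (v : EuclideanSpace ℝ (Fin n)) : ⟪Φ₀ + Φ₁, γ v (Φ₁ - Φ₀)⟫ = 0 := by
    simp [inner_add_left, inner_sub_right, hself, h10, h01']
  have hBA (v : EuclideanSpace ℝ (Fin n)) : ⟪Φ₁ - Φ₀, γ v (Φ₀ + Φ₁)⟫ = 0 := by
    simp [inner_sub_left, inner_add_right, hself, h10, h01']
  have hA : ‖Φ₀ + Φ₁‖ ^ 2 = ‖Φ₀‖ ^ 2 + ‖Φ₁‖ ^ 2 := by
    rw [norm_add_sq_real, h01]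
    ring
  have hB : ‖Φ₁ - Φ₀‖ ^ 2 = ‖Φ₀‖ ^ 2 + ‖Φ₁‖ ^ 2 := by
    rw [norm_sub_sq_real, real_inner_comm, h01]
    ring
  have hφ' : φ = fun y => ((2 / (1 + ‖y‖ ^ 2) : ℝ) ^ ((n : ℝ) / 2)) •
      ((Φ₀ + Φ₁) + γ y (Φ₁ - Φ₀)) := by
    rw [hφ]
    funext y
    simp only [psiNeg, psiPos, map_sub]
    module
  have hpos : 0 < 1 + ‖x‖ ^ 2 := by positivity
  have hsq := two_div_rpow_half_sq n hpos
  constructor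
  · rw [hφ', norm_smul, mul_pow, Real.norm_eq_abs, sq_abs, hsq,
      norm_sq_add_clifford_mul γ hcl hsk hAB, hA, hB, sub_eq_neg_add,
      Real.rpow_add_one hpos.ne']
    ring
  · have hD : Dirac γ φ x = (-n * (2 / (1 + ‖x‖ ^ 2)) ^ ((n : ℝ) / 2) / (1 + ‖x‖ ^ 2)) •
        ((Φ₁ - Φ₀) + γ x (Φ₀ + Φ₁)) := by
      rw [hφ', Dirac_smul_add_clifford γ hcl _ _
        (hasFDerivAt_two_div_one_add_norm_sq_rpow ((n : ℝ) / 2) x),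
        mul_div_cancel₀ _ two_ne_zero]
      match_scalars <;> field_simp <;> ring
    rw [hD, norm_smul, mul_pow, Real.norm_eq_abs, sq_abs, div_pow, mul_pow, hsq,
      norm_sq_add_clifford_mul γ hcl hsk hBA, hA, hB, Real.rpow_sub_one hpos.ne']
    field_simp
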